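/- arXiv:1901.04069 — 3 statements merged into one kernel-verified Lean document; each statement's English description precedes it below -/
import Mathlib

section
/- Let a(n) be the number of compositions of n that avoid, in the sense of containment, the composition (2,3,2). Then in the ring of formal power series over ℚ, (Σ_{n≥0} a(n) xⁿ) · (x⁶ − x⁵ + 2x⁴ − x³ − 2x² + 3x − 1) = −(1 − 2x + x² + x³ − x⁴ + x⁵). -/
/-- `Occurs b c i` says that the composition (list) `b = (b_1, …, b_s)` occurs in
`c = (c_1, …, c_k)` at (0-indexed) position `i`: `i + s ≤ k` and `b_j ≤ c_{i+j}`
for all `0 ≤ j < s`. -/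
def Occurs (b c : List ℕ) (i : ℕ) : Prop :=
  i + b.length ≤ c.length ∧ ∀ j < b.length, b.getD j 0 ≤ c.getD (i + j) 0

instance (b c : List ℕ) (i : ℕ) : Decidable (Occurs b c i) :=
  inferInstanceAs
    (Decidable (i + b.length ≤ c.length ∧ ∀ j < b.length, b.getD j 0 ≤ c.getD (i + j) 0))

/-- The composition `c` includes (contains) the composition `b`. -/
def Contains (c b : List ℕ) : Prop := ∃ i, Occurs b c i

/-- The number of occurrences of `b` in `c` (number of positions at which `b` occurs). -/
def numOcc (b c : List ℕ) : ℕ :=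
  ((Finset.range (c.length + 1)).filter fun i => Occurs b c i).card

local notation "x" => (PowerSeries.X : PowerSeries ℚ)

def incP (P : List ℕ → Prop) : List ℕ → Prop
  | [] => False
  | k :: t => P ((k + 1) :: t)

def SS (P : List ℕ → Prop) (n : ℕ) : Set (List ℕ) :=
  {l | (∀ i ∈ l, 0 < i) ∧ l.sum = n ∧ P l}

def incHead : List ℕ → List ℕ
  | [] => []
  | k :: t => (k + 1) :: t

lemma incHead_inj : Function.Injective incHead := by
  intro a b h
  cases a <;> cases b <;> simp_all [incHead]

lemma SS_zero (P : List ℕ → Prop) : SS P 0 = {l | l = [] ∧ P []} := by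
  ext l
  cases l with
  | nil => simp [SS]
  | cons k t =>
    simp only [SS, Set.mem_ofPred_eq, List.mem_cons, List.sum_cons]
    constructor
    · rintro ⟨h1, h2, -⟩
      have := h1 k (Or.inl rfl)
      omega
    · rintro ⟨h, -⟩
      cases h

lemma SS_succ (P : List ℕ → Prop) (n : ℕ) :
    SS P (n + 1) = (List.cons 1) '' SS (fun l => P (1 :: l)) n ∪ incHead '' SS (incP P) n := by
  ext l
  constructor
  · rintro ⟨h1, h2, h3⟩
    rcases l with _ | ⟨k, t⟩
    · simp at h2
    · have hk := h1 k (by simp)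
      have ht : ∀ i ∈ t, 0 < i := fun i hi => h1 i (by simp [hi])
      simp only [List.sum_cons] at h2
      rcases k with _ | _ | k
      · omega
      · left
        exact ⟨t, ⟨ht, by omega, h3⟩, rfl⟩
      · right
        refine ⟨(k + 1) :: t, ⟨?_, ?_, h3⟩, rfl⟩
        · intro i hi
          rcases List.mem_cons.1 hi with rfl | hi
          · omega
          · exact ht i hi
        · simp only [List.sum_cons]; omega
  · rintro (⟨t, ⟨h1, h2, h3⟩, rfl⟩ | ⟨t, ⟨h1, h2, h3⟩, rfl⟩)
    · refine ⟨?_, ?_, h3⟩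
      · intro i hi
        rcases List.mem_cons.1 hi with rfl | hi
        · omega
        · exact h1 i hi
      · simp only [List.sum_cons]; omega
    · rcases t with _ | ⟨k, t⟩
      · exact h3.elim
      · refine ⟨?_, ?_, h3⟩
        · intro i hi
          rcases List.mem_cons.1 hi with rfl | hi
          · omega
          · exact h1 i (by simp [hi])
        · simp only [List.sum_cons, incHead] at h2 ⊢; omega

lemma SS_finite (n : ℕ) : ∀ P, (SS P n).Finite := by
  induction n with
  | zero => intro P; rw [SS_zero]; exact (Set.finite_singleton []).subset (fun l h => h.1)
  | succ n ih => intro P; rw [SS_succ]; exact ((ih _).image _).union ((ih _).image _)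

noncomputable def NN (P : List ℕ → Prop) (n : ℕ) : ℕ := (SS P n).ncard

lemma NN_succ (P : List ℕ → Prop) (n : ℕ) :
    NN P (n + 1) = NN (fun l => P (1 :: l)) n + NN (incP P) n := by
  unfold NN
  rw [SS_succ, Set.ncard_union_eq _ ((SS_finite _ _).image _) ((SS_finite _ _).image _),
    Set.ncard_image_of_injective _ (List.cons_injective),
    Set.ncard_image_of_injective _ incHead_inj]
  rw [Set.disjoint_left]
  rintro _ ⟨t, ⟨h1, h2, h3⟩, rfl⟩ ⟨s, ⟨g1, g2, g3⟩, h⟩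
  rcases s with _ | ⟨k, s⟩
  · exact g3
  · have := g1 k (by simp)
    simp only [incHead, List.cons.injEq] at h
    omega

lemma NN_zero_pos (P : List ℕ → Prop) (h : P []) : NN P 0 = 1 := by
  unfold NN; rw [SS_zero]; simp [h]

lemma NN_zero_neg (P : List ℕ → Prop) (h : ¬ P []) : NN P 0 = 0 := by
  unfold NN; rw [SS_zero]; simp [h]

lemma NN_congr {P Q : List ℕ → Prop} (h : ∀ l, (∀ i ∈ l, 0 < i) → (P l ↔ Q l)) (n : ℕ) :
    NN P n = NN Q n := by
  unfold NN
  congr 1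
  ext l
  simp only [SS, Set.mem_ofPred_eq]
  constructor
  · rintro ⟨h1, h2, h3⟩; exact ⟨h1, h2, (h l h1).1 h3⟩
  · rintro ⟨h1, h2, h3⟩; exact ⟨h1, h2, (h l h1).2 h3⟩

lemma NN_false {P : List ℕ → Prop} (h : ∀ l, (∀ i ∈ l, 0 < i) → ¬ P l) (n : ℕ) :
    NN P n = 0 := by
  unfold NN
  have : SS P n = ∅ := by
    ext l
    simp only [SS, Set.mem_ofPred_eq, Set.mem_empty_iff_false, iff_false]
    rintro ⟨h1, h2, h3⟩; exact h l h1 h3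
  rw [this, Set.ncard_empty]

lemma card_eq_NN (P : List ℕ → Prop) (n : ℕ) :
    Nat.card {c : Composition n // P c.blocks} = NN P n := by
  unfold NN
  rw [← Nat.card_coe_set_eq]
  refine Nat.card_congr
    ⟨fun c => ⟨c.1.blocks, fun i hi => c.1.blocks_pos hi, c.1.blocks_sum, c.2⟩,
     fun l => ⟨⟨l.1, fun {i} hi => l.2.1 i hi, l.2.2.1⟩, l.2.2.2⟩, ?_, ?_⟩
  · intro c; rfl
  · intro l; rfl

def AV (l : List ℕ) : Prop := ¬ Contains l [2, 3, 2]

lemma occurs_iff (c : List ℕ) (i : ℕ) : Occurs [2, 3, 2] c i ↔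
    i + 3 ≤ c.length ∧ 2 ≤ c.getD i 0 ∧ 3 ≤ c.getD (i + 1) 0 ∧ 2 ≤ c.getD (i + 2) 0 := by
  unfold Occurs
  constructor
  · rintro ⟨h, g⟩
    exact ⟨h, g 0 (by simp), g 1 (by simp), g 2 (by simp)⟩
  · rintro ⟨h, g0, g1, g2⟩
    refine ⟨h, ?_⟩
    intro j hj
    simp only [List.length_cons, List.length_nil] at hj
    interval_cases j
    · exact g0
    · exact g1
    · exact g2

lemma AV_nil : AV [] := by
  rintro ⟨i, h⟩; rw [occurs_iff] at h; simp at h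

lemma AV_one (a : ℕ) : AV [a] := by
  rintro ⟨i, h⟩; rw [occurs_iff] at h; simp at h

lemma AV_two (a b : ℕ) : AV [a, b] := by
  rintro ⟨i, h⟩; rw [occurs_iff] at h; have := h.1; simp at this

lemma AV_cons (a b c : ℕ) (t : List ℕ) :
    AV (a :: b :: c :: t) ↔ ¬ (2 ≤ a ∧ 3 ≤ b ∧ 2 ≤ c) ∧ AV (b :: c :: t) := by
  unfold AV
  rw [← not_or, not_iff_not]
  constructor
  · rintro ⟨i, h⟩
    rcases i with _ | i
    · rw [occurs_iff] at h
      left; simpa using h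
    · right
      refine ⟨i, ?_⟩
      rw [occurs_iff] at h ⊢
      refine ⟨by have := h.1; simp at this ⊢; omega, ?_⟩
      have := h.2
      simpa only [Nat.add_right_comm i 1, List.getD_cons_succ] using this
  · rintro (h | ⟨i, h⟩)
    · refine ⟨0, ?_⟩
      rw [occurs_iff]; simpa using h
    · refine ⟨i + 1, ?_⟩
      rw [occurs_iff] at h ⊢
      refine ⟨by have := h.1; simp at this ⊢; omega, ?_⟩
      have := h.2
      simpa only [Nat.add_right_comm i 1, List.getD_cons_succ] using this

lemma AV_1 (t : List ℕ) : AV (1 :: t) ↔ AV t := by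
  rcases t with _ | ⟨a, _ | ⟨b, t⟩⟩ <;> simp [AV_nil, AV_one, AV_two, AV_cons]

lemma AV_21 (a : ℕ) (t : List ℕ) : AV (a :: 1 :: t) ↔ AV t := by
  rcases t with _ | ⟨b, t⟩
  · simp [AV_nil, AV_two]
  · simp [AV_cons, AV_1]

lemma AV_22 (t : List ℕ) : AV (2 :: 2 :: t) ↔ AV (2 :: t) := by
  rcases t with _ | ⟨b, t⟩ <;> simp [AV_one, AV_two, AV_cons]

lemma AV_231 (t : List ℕ) : AV (2 :: 3 :: 1 :: t) ↔ AV t := by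
  simp [AV_cons, AV_21]

lemma AV_ge (k : ℕ) (t : List ℕ) : AV ((k + 2) :: t) ↔ AV (2 :: t) := by
  rcases t with _ | ⟨a, _ | ⟨b, t⟩⟩ <;> simp [AV_one, AV_two, AV_cons]

lemma AV_2ge (k : ℕ) (t : List ℕ) : AV (2 :: (k + 3) :: t) ↔ AV (2 :: 3 :: t) := by
  rcases t with _ | ⟨a, t⟩
  · simp [AV_two]
  · rw [AV_cons, AV_cons, AV_ge (k + 1), AV_ge 1]; simp

lemma AV_23 (k : ℕ) (t : List ℕ) : ¬ AV (2 :: 3 :: (k + 2) :: t) := by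
  simp [AV_cons]

def DP := incP AV
def BP : List ℕ → Prop := fun l => AV (2 :: l)
def FP := incP BP
def EP := incP FP
def CP : List ℕ → Prop := fun l => AV (2 :: 3 :: l)

lemma rA (n : ℕ) : NN AV (n + 1) = NN AV n + NN DP n := by
  rw [NN_succ]; congr 1
  exact NN_congr (fun l _ => AV_1 l) n

lemma rD (n : ℕ) : NN DP (n + 1) = NN BP n + NN DP n := by
  rw [NN_succ]; congr 1
  refine NN_congr (fun l hl => ?_) n
  rcases l with _ | ⟨_ | k, t⟩
  · exact Iff.rfl
  · simp at hl
  · exact (AV_ge (k + 1) t).trans (AV_ge k t).symm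

lemma rB (n : ℕ) : NN BP (n + 1) = NN AV n + NN FP n := by
  rw [NN_succ]; congr 1
  exact NN_congr (fun l _ => AV_21 2 l) n

lemma rF (n : ℕ) : NN FP (n + 1) = NN BP n + NN EP n := by
  rw [NN_succ]; congr 1
  exact NN_congr (fun l _ => AV_22 l) n

lemma rE (n : ℕ) : NN EP (n + 1) = NN CP n + NN EP n := by
  rw [NN_succ]; congr 1
  refine NN_congr (fun l hl => ?_) n
  rcases l with _ | ⟨_ | k, t⟩
  · exact Iff.rfl
  · simp at hl
  · exact (AV_2ge (k + 1) t).trans (AV_2ge k t).symm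

lemma rC (n : ℕ) : NN CP (n + 1) = NN AV n := by
  rw [NN_succ, NN_false (P := incP CP), add_zero]
  · exact NN_congr (fun l _ => AV_231 l) n
  · intro l hl
    rcases l with _ | ⟨_ | k, t⟩
    · exact id
    · simp at hl
    · exact AV_23 k t

noncomputable def GG (P : List ℕ → Prop) : PowerSeries ℚ := PowerSeries.mk fun n => (NN P n : ℚ)

lemma GG_one {P : List ℕ → Prop} {g : PowerSeries ℚ} (h0 : P [])
    (h : ∀ n, (NN P (n + 1) : ℚ) = PowerSeries.coeff n g) :
    GG P = 1 + PowerSeries.X * g := by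
  ext n
  rcases n with _ | n
  · simp [GG, NN_zero_pos P h0]
  · simp [GG, h, PowerSeries.coeff_succ_X_mul, PowerSeries.coeff_one]

lemma GG_zero {P : List ℕ → Prop} {g : PowerSeries ℚ} (h0 : ¬ P [])
    (h : ∀ n, (NN P (n + 1) : ℚ) = PowerSeries.coeff n g) :
    GG P = PowerSeries.X * g := by
  ext n
  rcases n with _ | n
  · simp [GG, NN_zero_neg P h0]
  · simp [GG, h, PowerSeries.coeff_succ_X_mul]


/-- If `a n` is the number of compositions of `n` avoiding (by containment) the
composition `(2,3,2)`, then in `ℚ[[x]]`: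
`(∑ a(n) xⁿ) ⬝ (x⁶ - x⁵ + 2x⁴ - x³ - 2x² + 3x - 1) = -(1 - 2x + x² + x³ - x⁴ + x⁵)`. -/
theorem gf_avoid_232 (a : ℕ → ℕ)
    (ha : ∀ n, a n = Nat.card {c : Composition n // ¬ Contains c.blocks [2, 3, 2]}) :
    PowerSeries.mk (fun n => (a n : ℚ)) *
        (x ^ 6 - x ^ 5 + 2 * x ^ 4 - x ^ 3 - 2 * x ^ 2 + 3 * x - 1) =
      -(1 - 2 * x + x ^ 2 + x ^ 3 - x ^ 4 + x ^ 5) := by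
  have hG : PowerSeries.mk (fun n => (a n : ℚ)) = GG AV := by
    ext n
    simp only [GG, PowerSeries.coeff_mk, ha n]
    exact_mod_cast card_eq_NN AV n
  have hA : GG AV = 1 + x * (GG AV + GG DP) :=
    GG_one AV_nil (fun n => by simp [GG, rA])
  have hD : GG DP = x * (GG BP + GG DP) :=
    GG_zero id (fun n => by simp [GG, rD])
  have hB : GG BP = 1 + x * (GG AV + GG FP) :=
    GG_one (AV_one 2) (fun n => by simp [GG, rB])
  have hF : GG FP = x * (GG BP + GG EP) :=
    GG_zero id (fun n => by simp [GG, rF])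
  have hE : GG EP = x * (GG CP + GG EP) :=
    GG_zero id (fun n => by simp [GG, rE])
  have hC : GG CP = 1 + x * GG AV :=
    GG_one (AV_two 2 3) (fun n => by simp [GG, rC])
  rw [hG]
  linear_combination (-(1 - x) ^ 2 * (1 - x ^ 2)) * hA - x * (1 - x) * (1 - x ^ 2) * hD
    - x ^ 2 * (1 - x) * hB - x ^ 3 * (1 - x) * hF - x ^ 4 * hE - x ^ 5 * hC
end

section
/- Let a(n) be the number of compositions of n that avoid, in the sense of containment, the composition (3,4,5,4,3). Then in the ring of formal power series over ℚ, (Σ_{n≥0} a(n) xⁿ) · (x¹⁸ + x¹⁷ − x¹⁶ + 2x¹⁴ − x¹³ − 2x¹¹ + 3x¹⁰ − x⁹ + 2x⁸ − 5x⁷ + 4x⁶ − x⁵ − 2x⁴ + 7x³ − 9x² + 5x − 1) = −(1 − 4x + 6x² − 4x³ + x⁴ + x⁵ − 3x⁶ + 3x⁷ − x⁸ + x⁹ − 2x¹⁰ + x¹¹ + x¹³ − x¹⁴ + x¹⁶). -/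
local notation "x" => (PowerSeries.X : PowerSeries ℚ)

open PowerSeries in
lemma mk_antidiag_step (f : ℕ → ℕ → ℚ) :
    PowerSeries.mk (fun n => ∑ p ∈ Finset.HasAntidiagonal.antidiagonal n, f p.1 p.2) =
      PowerSeries.mk (f 0) +
        x * PowerSeries.mk (fun n => ∑ p ∈ Finset.HasAntidiagonal.antidiagonal n, f (p.1 + 1) p.2) := by
  ext n
  cases n with
  | zero => simp
  | succ n =>
    rw [map_add, PowerSeries.coeff_succ_X_mul]
    simp [Finset.Nat.antidiagonal_succ]

lemma mk_antidiag_const (f : ℕ → ℚ) :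
    PowerSeries.mk (fun n => ∑ p ∈ Finset.HasAntidiagonal.antidiagonal n, f p.2) * (1 - x) =
      PowerSeries.mk f := by
  have h : PowerSeries.mk (fun n => ∑ p ∈ Finset.HasAntidiagonal.antidiagonal n, f p.2) =
      PowerSeries.mk (fun _ => (1 : ℚ)) * PowerSeries.mk f := by
    ext n
    simp [PowerSeries.coeff_mul]
  have h1 : PowerSeries.mk (fun _ => (1 : ℚ)) * (1 - x) = 1 :=
    PowerSeries.mk_one_mul_one_sub_eq_one ℚ
  rw [h]
  linear_combination PowerSeries.mk f * h1

/-- transition of the automaton; state 5 is dead -/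
def st : ℕ → ℕ → ℕ
  | 0, k => if k ≤ 2 then 0 else 1
  | 1, k => if k ≤ 2 then 0 else if k = 3 then 1 else 2
  | 2, k => if k ≤ 2 then 0 else if k = 3 then 1 else if k = 4 then 2 else 3
  | 3, k => if k ≤ 2 then 0 else if k = 3 then 1 else 4
  | 4, k => if k ≤ 2 then 0 else 5
  | _, _ => 5

lemma st_const (s i : ℕ) (h : 4 ≤ i) : st s (i + 1) = st s 5 := by
  rcases s with _ | _ | _ | _ | _ | s <;> simp only [st] <;> split_ifs <;> omega

def okl : ℕ → List ℕ → Prop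
  | s, [] => s < 5
  | s, k :: c => okl (st s k) c

def pm : List ℕ → List ℕ → Prop
  | [], _ => True
  | _ :: _, [] => False
  | b :: bs, a :: as => b ≤ a ∧ pm bs as

lemma occurs_zero_iff (b c : List ℕ) : Occurs b c 0 ↔ pm b c := by
  induction b generalizing c with
  | nil => simp [Occurs, pm]
  | cons b bs ih =>
    cases c with
    | nil => simp [Occurs, pm]
    | cons a as =>
      rw [pm, ← ih]
      unfold Occurs
      constructor
      · rintro ⟨h1, h2⟩
        refine ⟨by simpa using h2 0 (by simp), by simpa using h1, fun j hj => ?_⟩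
        have := h2 (j + 1) (by simpa using hj)
        simpa using this
      · rintro ⟨h0, h1, h2⟩
        refine ⟨by simpa using h1, fun j hj => ?_⟩
        cases j with
        | zero => simpa using h0
        | succ j =>
          have := h2 j (by simpa using hj)
          simpa using this

lemma contains_cons (b c : List ℕ) (k : ℕ) :
    Contains (k :: c) b ↔ pm b (k :: c) ∨ Contains c b := by
  rw [← occurs_zero_iff]
  have key : ∀ i, Occurs b (k :: c) (i + 1) ↔ Occurs b c i := by
    intro i
    unfold Occurs
    have : ∀ j, i + 1 + j = (i + j) + 1 := by intro j; omega
    simp only [this, List.getD_cons_succ, List.length_cons]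
    constructor
    · rintro ⟨h1, h2⟩; exact ⟨by omega, h2⟩
    · rintro ⟨h1, h2⟩; exact ⟨by omega, h2⟩
  constructor
  · rintro ⟨i, hi⟩
    cases i with
    | zero => exact Or.inl hi
    | succ i => exact Or.inr ⟨i, (key i).1 hi⟩
  · rintro (h | ⟨i, hi⟩)
    · exact ⟨0, h⟩
    · exact ⟨i + 1, (key i).2 hi⟩

lemma okl_five (c : List ℕ) : ¬ okl 5 c := by
  induction c with
  | nil => simp [okl]
  | cons k c ih => simpa [okl, st] using ih

lemma okl_char (c : List ℕ) :
    (okl 0 c ↔ ¬ Contains c [3, 4, 5, 4, 3]) ∧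
    (okl 1 c ↔ ¬ Contains c [3, 4, 5, 4, 3] ∧ ¬ pm [4, 5, 4, 3] c) ∧
    (okl 2 c ↔ ¬ Contains c [3, 4, 5, 4, 3] ∧ ¬ pm [4, 5, 4, 3] c ∧ ¬ pm [5, 4, 3] c) ∧
    (okl 3 c ↔ ¬ Contains c [3, 4, 5, 4, 3] ∧ ¬ pm [4, 5, 4, 3] c ∧ ¬ pm [5, 4, 3] c ∧
      ¬ pm [4, 3] c) ∧
    (okl 4 c ↔ ¬ Contains c [3, 4, 5, 4, 3] ∧ ¬ pm [4, 5, 4, 3] c ∧ ¬ pm [5, 4, 3] c ∧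
      ¬ pm [3] c) := by
  induction c with
  | nil => simp [okl, pm, Contains, Occurs]
  | cons k c ih =>
    obtain ⟨h0, h1, h2, h3, h4⟩ := ih
    have h5 := okl_five c
    have h6 : pm [4, 3] c → pm [3] c := by
      cases c with
      | nil => simp [pm]
      | cons a c => simp only [pm]; intro h; exact ⟨by omega, trivial⟩
    have hk : k ≤ 2 ∨ k = 3 ∨ k = 4 ∨ 5 ≤ k := by omega
    have e0 : pm [] c := by simp [pm]
    simp only [contains_cons, okl]
    rcases hk with hk | rfl | rfl | hk
    · have a3 : ¬ 3 ≤ k := by omega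
      have a4 : ¬ 4 ≤ k := by omega
      have a5 : ¬ 5 ≤ k := by omega
      simp [st, pm, hk, a3, a4, a5, h0]
    · simp [st, pm, h1, h5]; clear h0 h1 h2 h3 h4 h5; grind
    · simp [st, pm, h1, h2, h4, h5]; clear h0 h1 h2 h3 h4 h5; grind
    · have a2 : ¬ k ≤ 2 := by omega
      have a3 : 3 ≤ k := by omega
      have a4 : 4 ≤ k := by omega
      have b3 : k ≠ 3 := by omega
      have b4 : k ≠ 4 := by omega
      simp [st, pm, hk, a2, a3, a4, b3, b4, h1, h2, h3, h4, h5]; clear h0 h1 h2 h3 h4 h5; grind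

abbrev LT' (s n : ℕ) : Type := {c : List ℕ // (∀ i ∈ c, 0 < i) ∧ c.sum = n ∧ okl s c}

noncomputable def cnt (s n : ℕ) : ℕ := Nat.card (LT' s n)

def compEquiv (s n : ℕ) : {c : Composition n // okl s c.blocks} ≃ LT' s n where
  toFun c := ⟨c.1.blocks, fun _ h => c.1.blocks_pos h, c.1.blocks_sum, c.2⟩
  invFun c := ⟨⟨c.1, fun {i} h => c.2.1 i h, c.2.2.1⟩, c.2.2.2⟩
  left_inv _ := rfl
  right_inv _ := rfl

instance (s n : ℕ) : Finite (LT' s n) := Finite.of_equiv _ (compEquiv s n)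

lemma cnt_zero (s : ℕ) (hs : s < 5) : cnt s 0 = 1 := by
  unfold cnt
  rw [Nat.card_eq_one_iff_unique]
  refine ⟨⟨?_⟩, ⟨⟨[], by simp [okl, hs]⟩⟩⟩
  have : ∀ a : LT' s 0, a.1 = [] := by
    rintro ⟨c, h1, h2, h3⟩
    cases c with
    | nil => rfl
    | cons k c =>
      have := h1 k (by simp)
      simp at h2
      omega
  intro a b
  exact Subtype.ext ((this a).trans (this b).symm)

lemma cnt_five (n : ℕ) : cnt 5 n = 0 := by
  unfold cnt
  have : IsEmpty (LT' 5 n) := ⟨fun c => okl_five _ c.2.2.2⟩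
  simp

noncomputable def consMap (s n : ℕ)
    (p : Σ p : Finset.HasAntidiagonal.antidiagonal n, LT' (st s (p.1.1 + 1)) p.1.2) : LT' s (n + 1) :=
  ⟨(p.1.1.1 + 1) :: p.2.1, by
    obtain ⟨⟨⟨i, j⟩, hij⟩, ⟨c, h1, h2, h3⟩⟩ := p
    simp only [Finset.HasAntidiagonal.mem_antidiagonal] at hij
    refine ⟨?_, ?_, h3⟩
    · intro a ha
      rcases List.mem_cons.1 ha with rfl | ha
      · simp
      · exact h1 a ha
    · simp only [List.sum_cons] at h2 ⊢
      omega⟩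

lemma consMap_bij (s n : ℕ) : Function.Bijective (consMap s n) := by
  constructor
  · rintro ⟨⟨⟨i, j⟩, hij⟩, ⟨c, h1, h2, h3⟩⟩ ⟨⟨⟨i', j'⟩, hij'⟩, ⟨c', h1', h2', h3'⟩⟩ h
    simp only [consMap, Subtype.mk.injEq, List.cons.injEq] at h
    obtain ⟨ha, rfl⟩ := h
    obtain rfl : i = i' := by omega
    dsimp only at h2 h2'
    subst h2
    subst h2'
    rfl
  · rintro ⟨c, h1, h2, h3⟩
    cases c with
    | nil => simp at h2
    | cons k c =>
      have hk := h1 k (by simp)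
      obtain ⟨i, rfl⟩ : ∃ i, k = i + 1 := ⟨k - 1, by omega⟩
      simp only [List.sum_cons] at h2
      exact ⟨⟨⟨(i, c.sum), by simp only [Finset.HasAntidiagonal.mem_antidiagonal]; omega⟩,
        ⟨c, fun a ha => h1 a (by simp [ha]), rfl, h3⟩⟩, rfl⟩

lemma cnt_succ (s n : ℕ) :
    cnt s (n + 1) = ∑ p ∈ Finset.HasAntidiagonal.antidiagonal n, cnt (st s (p.1 + 1)) p.2 := by
  unfold cnt
  rw [← Nat.card_congr (Equiv.ofBijective _ (consMap_bij s n)), Nat.card_sigma]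
  exact Finset.sum_coe_sort (Finset.HasAntidiagonal.antidiagonal n)
    (fun p => Nat.card (LT' (st s (p.1 + 1)) p.2))

noncomputable def FF (s : ℕ) : PowerSeries ℚ := PowerSeries.mk (fun n => (cnt s n : ℚ))

lemma FF_five : FF 5 = 0 := by
  ext n
  simp [FF, cnt_five]

lemma FF_rec (s : ℕ) (hs : s < 5) :
    (1 - x) * FF s = (1 - x) * (1 + x * FF (st s 1) + x ^ 2 * FF (st s 2) + x ^ 3 * FF (st s 3)
      + x ^ 4 * FF (st s 4)) + x ^ 5 * FF (st s 5) := by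
  have h : FF s = 1 + x * PowerSeries.mk (fun n => ∑ p ∈ Finset.HasAntidiagonal.antidiagonal n,
      (cnt (st s (p.1 + 1)) p.2 : ℚ)) := by
    ext n
    cases n with
    | zero => simp [FF, cnt_zero s hs]
    | succ n =>
      rw [map_add, PowerSeries.coeff_succ_X_mul]
      simp [FF, cnt_succ, PowerSeries.coeff_one]
  have e1 := mk_antidiag_step (fun i j => (cnt (st s (i + 1)) j : ℚ))
  have e2 := mk_antidiag_step (fun i j => (cnt (st s (i + 1 + 1)) j : ℚ))
  have e3 := mk_antidiag_step (fun i j => (cnt (st s (i + 1 + 1 + 1)) j : ℚ))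
  have e4 := mk_antidiag_step (fun i j => (cnt (st s (i + 1 + 1 + 1 + 1)) j : ℚ))
  have e5 := mk_antidiag_const (fun j => (cnt (st s 5) j : ℚ))
  have hc : ∀ i, st s (i + 1 + 1 + 1 + 1 + 1) = st s 5 := fun i => st_const s _ (by omega)
  simp only [hc] at e4
  simp only [zero_add, Nat.reduceAdd] at e1 e2 e3 e4
  change _ = FF (st s 1) + _ at e1
  change _ = FF (st s 2) + _ at e2
  change _ = FF (st s 3) + _ at e3
  change _ = FF (st s 4) + _ at e4
  change _ = FF (st s 5) at e5
  rw [e1, e2, e3, e4] at h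
  linear_combination (1 - x) * h + x ^ 5 * e5

/-- Theorem 1 of the paper: if `a n` is the number of compositions of `n` avoiding
(by containment) the composition `(3,4,5,4,3)`, then in `ℚ[[x]]` the generating
function `∑ a(n) xⁿ` times the stated degree-18 polynomial equals minus the stated
degree-16 polynomial. -/
theorem gf_avoid_34543 (a : ℕ → ℕ)
    (ha : ∀ n, a n = Nat.card {c : Composition n // ¬ Contains c.blocks [3, 4, 5, 4, 3]}) :
    PowerSeries.mk (fun n => (a n : ℚ)) *
        (x ^ 18 + x ^ 17 - x ^ 16 + 2 * x ^ 14 - x ^ 13 - 2 * x ^ 11 + 3 * x ^ 10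
          - x ^ 9 + 2 * x ^ 8 - 5 * x ^ 7 + 4 * x ^ 6 - x ^ 5 - 2 * x ^ 4 + 7 * x ^ 3
          - 9 * x ^ 2 + 5 * x - 1) =
      -(1 - 4 * x + 6 * x ^ 2 - 4 * x ^ 3 + x ^ 4 + x ^ 5 - 3 * x ^ 6 + 3 * x ^ 7
          - x ^ 8 + x ^ 9 - 2 * x ^ 10 + x ^ 11 + x ^ 13 - x ^ 14 + x ^ 16) := by
  have hF : PowerSeries.mk (fun n => (a n : ℚ)) = FF 0 := by
    ext n
    simp only [FF, PowerSeries.coeff_mk, ha n, cnt]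
    rw [← Nat.card_congr (compEquiv 0 n)]
    simp only [(okl_char _).1]
  rw [hF]
  have r0 := FF_rec 0 (by norm_num)
  have r1 := FF_rec 1 (by norm_num)
  have r2 := FF_rec 2 (by norm_num)
  have r3 := FF_rec 3 (by norm_num)
  have r4 := FF_rec 4 (by norm_num)
  simp [st, FF_five] at r0 r1 r2 r3 r4
  have hx : (1 - x) ≠ 0 := by
    intro h
    have := congrArg (PowerSeries.constantCoeff (R := ℚ)) h
    simp at this
  have f4 : FF 4 = 1 + (x + x ^ 2) * FF 0 := by
    apply mul_left_cancel₀ hx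
    rcases r4 with r4 | r4
    · linear_combination (1 - x) * r4
    · exact absurd r4 hx
  generalize FF 0 = F0 at *
  generalize FF 1 = F1 at *
  generalize FF 2 = F2 at *
  generalize FF 3 = F3 at *
  generalize FF 4 = F4 at *
  subst f4
  have g1 : x ^ 3 * F1 = (1 - x) * (F0 - (1 + (x + x ^ 2) * F0)) := by
    linear_combination -r0
  have g2 : x ^ 7 * F2 = (1 - x) ^ 2 * (1 - x ^ 3) * (F0 - (1 + (x + x ^ 2) * F0))
      - x ^ 3 * (1 - x) * (1 + (x + x ^ 2) * F0) := by
    linear_combination (-x ^ 3) * r1 + (1 - x) * (1 - x ^ 3) * g1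
  have g3 : x ^ 12 * F3 = (1 - x) * (1 - x ^ 4) * (x ^ 7 * F2)
      - x ^ 7 * (1 - x) * (1 + (x + x ^ 2) * F0 + x ^ 3 * F1) := by
    linear_combination (-x ^ 7) * r2
  rw [g2, g1] at g3
  have g4 : (1 - x) * (x ^ 12 * F3) = x ^ 12 * ((1 - x) * (1 + (x + x ^ 2) * F0 + x ^ 3 * F1)
      + x ^ 4 * (1 + (x + x ^ 2) * F0)) := by
    linear_combination (x ^ 12) * r3
  rw [g3, g1] at g4
  linear_combination -g4
end

section
/- Let a(n) be the number of compositions of n that avoid, in the sense of containment, both (2,3,4) and (4,3,2). Then in the ring of formal power series over ℚ, (Σ_{n≥0} a(n) xⁿ) · (x¹⁷ + x¹⁶ + x¹³ + 2x¹¹ − x¹⁰ + x⁹ − x⁸ + x⁷ − 2x⁵ + x⁴ + 2x² − 3x + 1) = −(x¹⁶ + x¹⁵ + x¹² + 2x¹⁰ − x⁷ + x⁵ − x⁴ − x² + 2x − 1). -/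
local notation "x" => (PowerSeries.X : PowerSeries ℚ)

namespace GFAvoid

inductive St | A | B | C | D1 | D2 | E | R
  deriving DecidableEq

open St

/-- transition function -/
def dl : St → ℕ → St
  | A, k => if k ≤ 1 then A else if k ≤ 3 then B else D1
  | B, k => if k ≤ 1 then A else if k = 2 then B else if k = 3 then C else D2
  | C, k => if k ≤ 1 then A else if k = 2 then B else if k = 3 then C else R
  | D1, k => if k ≤ 1 then A else if k = 2 then B else E
  | D2, k => if k ≤ 1 then A else if k = 2 then B else if k = 3 then E else R
  | E, k => if k ≤ 1 then A else R
  | R, _ => R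

def ok : St → List ℕ → Prop
  | s, [] => s ≠ R
  | s, k :: l => ok (dl s k) l

/-- state after reading the letters `p`, `q` -/
def st (p q : ℕ) : St :=
  if q ≤ 1 then A else if q = 2 then B else
  if q = 3 then (if p ≤ 1 then B else if p ≤ 3 then C else E)
  else (if p ≤ 1 then D1 else if p ≤ 3 then D2 else E)

def bad (a b c : ℕ) : Prop := (2 ≤ a ∧ 3 ≤ b ∧ 4 ≤ c) ∨ (4 ≤ a ∧ 3 ≤ b ∧ 2 ≤ c)

def av (l : List ℕ) : Prop := ¬ Contains l [2, 3, 4] ∧ ¬ Contains l [4, 3, 2]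

lemma dl_bad (p q c : ℕ) (h : bad p q c) : dl (st p q) c = R := by
  unfold bad at h; unfold st
  grind [dl]

lemma dl_good (p q c : ℕ) (h : ¬ bad p q c) : dl (st p q) c = st q c := by
  unfold bad at h; unfold st
  grind [dl]

lemma st_ne (p q : ℕ) : st p q ≠ R := by
  unfold st; grind

lemma not_ok_R (l : List ℕ) : ¬ ok R l := by
  induction l with
  | nil => simp [ok]
  | cons k l ih => simpa [ok, dl] using ih

lemma contains_short (l : List ℕ) (b1 b2 b3 : ℕ) (h : l.length < 3) :
    ¬ Contains l [b1, b2, b3] := by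
  rintro ⟨i, h1, _⟩
  simp at h1; omega

lemma occ_succ (a : ℕ) (l b : List ℕ) (i : ℕ) : Occurs b (a :: l) (i + 1) ↔ Occurs b l i := by
  unfold Occurs
  have : ∀ j, i + 1 + j = (i + j) + 1 := fun j => by omega
  simp only [this, List.getD_cons_succ, List.length_cons]
  constructor
  · rintro ⟨h, h2⟩; exact ⟨by omega, h2⟩
  · rintro ⟨h, h2⟩; exact ⟨by omega, h2⟩

lemma contains_cons (a b c : ℕ) (l : List ℕ) (b1 b2 b3 : ℕ) :
    Contains (a :: b :: c :: l) [b1, b2, b3] ↔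
      (b1 ≤ a ∧ b2 ≤ b ∧ b3 ≤ c) ∨ Contains (b :: c :: l) [b1, b2, b3] := by
  have h0 : Occurs [b1, b2, b3] (a :: b :: c :: l) 0 ↔ (b1 ≤ a ∧ b2 ≤ b ∧ b3 ≤ c) := by
    unfold Occurs
    constructor
    · rintro ⟨_, h⟩
      exact ⟨by simpa using h 0 (by simp), by simpa using h 1 (by simp),
        by simpa using h 2 (by simp)⟩
    · rintro ⟨h1, h2, h3⟩
      refine ⟨by simp, ?_⟩
      intro j hj
      simp at hj
      interval_cases j <;> simpa
  unfold Contains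
  constructor
  · rintro ⟨i, hi⟩
    cases i with
    | zero => exact Or.inl (h0.1 hi)
    | succ i => exact Or.inr ⟨i, (occ_succ _ _ _ _).1 hi⟩
  · rintro (h | ⟨i, hi⟩)
    · exact ⟨0, h0.2 h⟩
    · exact ⟨i + 1, (occ_succ _ _ _ _).2 hi⟩

lemma av_short (l : List ℕ) (h : l.length < 3) : av l :=
  ⟨contains_short l _ _ _ h, contains_short l _ _ _ h⟩

lemma av_cons (a b c : ℕ) (l : List ℕ) :
    av (a :: b :: c :: l) ↔ ¬ bad a b c ∧ av (b :: c :: l) := by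
  unfold av bad
  rw [contains_cons, contains_cons]
  tauto

lemma ok_iff (l : List ℕ) (p q : ℕ) : ok (st p q) l ↔ av (p :: q :: l) := by
  induction l generalizing p q with
  | nil => simp [ok, st_ne, av_short]
  | cons c l ih =>
    rw [av_cons]
    by_cases h : bad p q c
    · simp [ok, dl_bad p q c h, h, not_ok_R]
    · simp [ok, dl_good p q c h, h, ih]

lemma av_one (l : List ℕ) : av (1 :: l) ↔ av l := by
  match l with
  | [] => simp [av_short]
  | [b] => simp [av_short]
  | b :: c :: l => rw [av_cons]; simp [bad]

lemma ok_A (l : List ℕ) : ok A l ↔ av l := by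
  have : A = st 1 1 := by simp [st]
  rw [this, ok_iff, av_one, av_one]

/-- words counted -/
abbrev W (s : St) (n : ℕ) : Type := {l : List ℕ // (∀ i ∈ l, 0 < i) ∧ l.sum = n ∧ ok s l}

def toComp (s : St) (n : ℕ) (w : W s n) : Composition n :=
  ⟨w.1, fun {i} hi => w.2.1 i hi, w.2.2.1⟩

instance (s : St) (n : ℕ) : Finite (W s n) :=
  Finite.of_injective (toComp s n) (by
    intro a b h
    exact Subtype.ext (congrArg Composition.blocks h))

noncomputable def f (s : St) (n : ℕ) : ℕ := Nat.card (W s n)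

lemma f_zero (s : St) (hs : s ≠ R) : f s 0 = 1 := by
  unfold f
  rw [Nat.card_eq_one_iff_unique]
  constructor
  · constructor
    rintro ⟨l, h1, h2, h3⟩ ⟨m, h4, h5, h6⟩
    have key : ∀ l : List ℕ, (∀ i ∈ l, 0 < i) → l.sum = 0 → l = [] := by
      intro l h1 h2
      cases l with
      | nil => rfl
      | cons a l => have := h1 a (by simp); simp at h2; omega
    simp [key l h1 h2, key m h4 h5]
  · exact ⟨⟨[], by simp, by simp, hs⟩⟩

lemma f_R (n : ℕ) : f R n = 0 := by
  unfold f
  have : IsEmpty (W R n) := ⟨fun w => not_ok_R _ w.2.2.2⟩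
  simp

noncomputable def eqv (s : St) (n : ℕ) : (Σ k : Fin (n + 1), W (dl s (k + 1)) (n - k)) ≃ W s (n + 1) :=
  Equiv.ofBijective
    (fun w => ⟨(w.1.1 + 1) :: w.2.1, by
      obtain ⟨⟨k, hk⟩, l, h1, h2, h3⟩ := w
      refine ⟨?_, ?_, h3⟩
      · intro i hi
        rcases List.mem_cons.1 hi with h | h
        · simp [h]
        · exact h1 i h
      · simp at h2 ⊢; omega⟩)
    (by
      constructor
      · rintro ⟨⟨k, hk⟩, l, h1⟩ ⟨⟨k', hk'⟩, l', h1'⟩ h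
        simp only [Subtype.mk.injEq, List.cons.injEq, Nat.add_right_cancel_iff] at h
        obtain ⟨rfl, rfl⟩ := h
        rfl
      · rintro ⟨l, h1, h2, h3⟩
        cases l with
        | nil => simp at h2
        | cons a l =>
          have ha := h1 a (by simp)
          obtain ⟨k, rfl⟩ : ∃ k, a = k + 1 := ⟨a - 1, by omega⟩
          simp at h2
          refine ⟨⟨⟨k, by omega⟩, ⟨l, fun i hi => h1 i (by simp [hi]), ?_, h3⟩⟩, rfl⟩
          simp; omega)

lemma f_succ (s : St) (n : ℕ) :
    f s (n + 1) = ∑ k ∈ Finset.range (n + 1), f (dl s (k + 1)) (n - k) := by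
  unfold f
  rw [← Nat.card_congr (eqv s n), Nat.card_sigma,
    Finset.sum_range (fun k => Nat.card (W (dl s (k + 1)) (n - k)))]

lemma dl_big (s : St) (k : ℕ) : dl s (k + 4) = dl s 4 := by
  cases s <;> simp [dl]

noncomputable def F (s : St) : PowerSeries ℚ := PowerSeries.mk fun n => (f s n : ℚ)

lemma F_R : F R = 0 := by
  ext n; simp [F, f_R]

lemma F_eq (s : St) (hs : s ≠ R) :
    F s = 1 + x * F (dl s 1) + x ^ 2 * F (dl s 2) + x ^ 3 * F (dl s 3)
      + x ^ 4 * (PowerSeries.mk 1 * F (dl s 4)) := by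
  ext n
  have e1 : (x : PowerSeries ℚ) * F (dl s 1) = x ^ 1 * F (dl s 1) := by rw [pow_one]
  rw [e1]
  simp only [map_add, PowerSeries.coeff_X_pow_mul', PowerSeries.coeff_one]
  match n with
  | 0 => simp [F, f_zero s hs]
  | 1 => simp [F, f_succ]
  | 2 => simp [F, f_succ s, Finset.sum_range_succ]
  | 3 => simp [F, f_succ s, Finset.sum_range_succ]
  | n + 4 =>
    have h : f s (n + 4) = f (dl s 1) (n + 3) + f (dl s 2) (n + 2) + f (dl s 3) (n + 1)
        + ∑ k ∈ Finset.range (n + 1), f (dl s 4) (n - k) := by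
      rw [f_succ, Finset.sum_range_succ', Finset.sum_range_succ', Finset.sum_range_succ']
      have : ∀ k, dl s (k + 1 + 1 + 1 + 1) = dl s 4 := fun k => dl_big s k
      simp only [this]
      have h2 : ∀ k, n + 3 - (k + 1 + 1 + 1) = n - k := fun k => by omega
      simp only [h2]
      simp
      ring
    rw [PowerSeries.coeff_mul, Finset.Nat.sum_antidiagonal_eq_sum_range_succ_mk]
    simp [F, h]

lemma main_F :
    F A * (x ^ 17 + x ^ 16 + x ^ 13 + 2 * x ^ 11 - x ^ 10 + x ^ 9 - x ^ 8 + x ^ 7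
          - 2 * x ^ 5 + x ^ 4 + 2 * x ^ 2 - 3 * x + 1) =
      -(x ^ 16 + x ^ 15 + x ^ 12 + 2 * x ^ 10 - x ^ 7 + x ^ 5 - x ^ 4 - x ^ 2
          + 2 * x - 1) := by
  have hA := F_eq A (by decide)
  have hB := F_eq B (by decide)
  have hC := F_eq C (by decide)
  have hD1 := F_eq D1 (by decide)
  have hD2 := F_eq D2 (by decide)
  have hE := F_eq E (by decide)
  simp only [show dl A 1 = A from rfl, show dl A 2 = B from rfl, show dl A 3 = B from rfl,
    show dl A 4 = D1 from rfl] at hA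
  simp only [show dl B 1 = A from rfl, show dl B 2 = B from rfl, show dl B 3 = C from rfl,
    show dl B 4 = D2 from rfl] at hB
  simp only [show dl C 1 = A from rfl, show dl C 2 = B from rfl, show dl C 3 = C from rfl,
    show dl C 4 = R from rfl, F_R] at hC
  simp only [show dl D1 1 = A from rfl, show dl D1 2 = B from rfl, show dl D1 3 = E from rfl,
    show dl D1 4 = E from rfl] at hD1
  simp only [show dl D2 1 = A from rfl, show dl D2 2 = B from rfl, show dl D2 3 = E from rfl,
    show dl D2 4 = R from rfl, F_R] at hD2
  simp only [show dl E 1 = A from rfl, show dl E 2 = R from rfl, show dl E 3 = R from rfl,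
    show dl E 4 = R from rfl, F_R] at hE
  have hg : (PowerSeries.mk 1 : PowerSeries ℚ) * (1 - x) = 1 :=
    PowerSeries.mk_one_mul_one_sub_eq_one ℚ
  have hne : (1 - x : PowerSeries ℚ) ≠ 0 := by
    intro h; rw [h, mul_zero] at hg; exact zero_ne_one hg
  generalize F A = a at *
  generalize F B = b at *
  generalize F C = c at *
  generalize F D1 = d1 at *
  generalize F D2 = d2 at *
  generalize F E = e at *
  generalize (PowerSeries.mk 1 : PowerSeries ℚ) = g at *
  generalize x = z at *
  have hE' : e = 1 + z * a := by linear_combination hE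
  have hD2' : d2 = 1 + z * a + z ^ 2 * b + z ^ 3 * (1 + z * a) := by
    rw [hE'] at hD2; linear_combination hD2
  have I : (1 - z) * (1 - z ^ 3) * b = (1 - z) * (1 + z * a + z ^ 2 * b)
      + z ^ 4 * (1 - z ^ 3) * (1 + z * a + z ^ 2 * b + z ^ 3 * (1 + z * a)) := by
    rw [hD2'] at hB
    linear_combination (1 - z) * (1 - z ^ 3) * hB + (1 - z) * z ^ 3 * hC
      + z ^ 4 * (1 - z ^ 3) * (1 + z * a + z ^ 2 * b + z ^ 3 * (1 + z * a)) * hg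
  have hD1' : (1 - z) * d1 = (1 - z) * (1 + z * a + z ^ 2 * b + z ^ 3 * (1 + z * a))
      + z ^ 4 * (1 + z * a) := by
    rw [hE'] at hD1
    linear_combination (1 - z) * hD1 + z ^ 4 * (1 + z * a) * hg
  have II : (1 - z) ^ 2 * a = (1 - z) ^ 2 * (1 + z * a + z ^ 2 * b + z ^ 3 * b)
      + z ^ 4 * (1 - z) * (1 + z * a + z ^ 2 * b + z ^ 3 * (1 + z * a))
      + z ^ 8 * (1 + z * a) := by
    linear_combination (1 - z) ^ 2 * hA + z ^ 4 * hD1' + z ^ 4 * (1 - z) * d1 * hg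
  apply mul_left_cancel₀ hne
  linear_combination ((1 - z) * (1 - z ^ 3) - z ^ 2 * (1 - z) - z ^ 6 * (1 - z ^ 3)) * II
    + ((1 - z) ^ 2 * (z ^ 2 + z ^ 3) + z ^ 6 * (1 - z)) * I

lemma card_eq (n : ℕ) : Nat.card {c : Composition n //
      ¬ Contains c.blocks [2, 3, 4] ∧ ¬ Contains c.blocks [4, 3, 2]} = f A n := by
  unfold f
  refine Nat.card_congr ⟨fun c => ⟨c.1.blocks, fun i hi => c.1.blocks_pos hi, c.1.blocks_sum,
    (ok_A _).2 c.2⟩, fun w => ⟨toComp A n w, (ok_A _).1 w.2.2.2⟩, ?_, ?_⟩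
  · intro c; rfl
  · intro c; rfl

end GFAvoid


/-- If `a n` is the number of compositions of `n` avoiding (by containment) both
`(2,3,4)` and `(4,3,2)`, then in `ℚ[[x]]` the generating function `∑ a(n) xⁿ` times
the stated degree-17 polynomial equals minus the stated degree-16 polynomial. -/
theorem gf_avoid_234_432 (a : ℕ → ℕ)
    (ha : ∀ n, a n = Nat.card {c : Composition n //
      ¬ Contains c.blocks [2, 3, 4] ∧ ¬ Contains c.blocks [4, 3, 2]}) :
    PowerSeries.mk (fun n => (a n : ℚ)) *
        (x ^ 17 + x ^ 16 + x ^ 13 + 2 * x ^ 11 - x ^ 10 + x ^ 9 - x ^ 8 + x ^ 7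
          - 2 * x ^ 5 + x ^ 4 + 2 * x ^ 2 - 3 * x + 1) =
      -(x ^ 16 + x ^ 15 + x ^ 12 + 2 * x ^ 10 - x ^ 7 + x ^ 5 - x ^ 4 - x ^ 2
          + 2 * x - 1) := by

  have h := GFAvoid.main_F
  have e : (fun n => (a n : ℚ)) = fun n => (GFAvoid.f GFAvoid.St.A n : ℚ) := by
    funext n; rw [ha, GFAvoid.card_eq]
  rw [e]
  exact h
end
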